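/- Let g ∈ {4,5}, and let i, j, k be nonnegative integers with i ≥ 1, j ≤ i, and k ≥ 1. If G ∈ F_{i,j} or G ∈ F^g_{i,j,k}, then for every vertex v of G there exists a feedback vertex set S of G with v ∈ S and |S| ≤ t_g·|E(G)| + ε_g(G). -/

import Mathlib

open SimpleGraph

namespace InducedForest

/-- A graph is subcubic if every vertex has at most 3 neighbours. -/
def Subcubic {V : Type} (G : SimpleGraph V) : Prop := ∀ v : V, (G.neighborSet v).ncard ≤ 3

/-- A graph is cubic if every vertex has exactly 3 neighbours. -/
def Cubic {V : Type} (G : SimpleGraph V) : Prop := ∀ v : V, (G.neighborSet v).ncard = 3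

/-- `S` is a feedback vertex set of `G` iff `G - S` is a forest. -/
def IsFVS {V : Type} (G : SimpleGraph V) (S : Set V) : Prop := (G.induce Sᶜ).IsAcyclic

/-- `φ(G)`: the minimum size of a feedback vertex set of `G`. -/
noncomputable def fvs {V : Type} (G : SimpleGraph V) : ℕ :=
  sInf {n : ℕ | ∃ S : Set V, IsFVS G S ∧ S.ncard = n}

/-- `a(G)`: the maximum number of vertices of an induced forest in `G`. -/
noncomputable def indForestNum {V : Type} (G : SimpleGraph V) : ℕ :=
  sSup {n : ℕ | ∃ S : Set V, (G.induce S).IsAcyclic ∧ S.ncard = n}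

/-- `v` is a cut-vertex of `G`: deleting it increases the number of connected components. -/
def IsCutVertex {V : Type} (G : SimpleGraph V) (v : V) : Prop :=
  Nat.card G.ConnectedComponent < Nat.card (G.induce {u | u ≠ v}).ConnectedComponent

/-- `B` is a block of `G`: a maximal set of vertices inducing a connected subgraph
without cut-vertices. -/
def IsBlock {V : Type} (G : SimpleGraph V) (B : Set V) : Prop :=
  ((G.induce B).Connected ∧ ∀ v, ¬ IsCutVertex (G.induce B) v) ∧
  ∀ B' : Set V, B ⊆ B' →
    ((G.induce B').Connected ∧ ∀ v, ¬ IsCutVertex (G.induce B') v) → B' = B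

/-- 2-connectedness: at least 3 vertices and removing fewer than 2 vertices
leaves a connected graph. -/
def TwoConnected {V : Type} (G : SimpleGraph V) : Prop :=
  3 ≤ Nat.card V ∧ ∀ s : Set V, s.ncard < 2 → (G.induce sᶜ).Connected

/-- 3-connectedness: at least 4 vertices and removing fewer than 3 vertices
leaves a connected graph. -/
def ThreeConnected {V : Type} (G : SimpleGraph V) : Prop :=
  4 ≤ Nat.card V ∧ ∀ s : Set V, s.ncard < 3 → (G.induce sᶜ).Connected

/-- The graph obtained from `H` by subdividing the edge `xy` once;
the subdivision vertex is `none`. -/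
def subdivide {V : Type} (H : SimpleGraph V) (x y : V) : SimpleGraph (Option V) :=
  SimpleGraph.fromRel (fun p q =>
    match p, q with
    | some u, some v => H.Adj u v ∧ s(u, v) ≠ s(x, y)
    | some u, none => u = x ∨ u = y
    | _, _ => False)

/-- `G` is obtained from `H` by subdividing one edge once. -/
def IsSubdivisionOfOneEdge {V W : Type} (H : SimpleGraph V) (G : SimpleGraph W) : Prop :=
  ∃ x y : V, H.Adj x y ∧ Nonempty (G ≃g subdivide H x y)

/-- The graph obtained from `K` by adding one new vertex (`none`)
joined to all vertices of `S`. -/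
def addApex {V : Type} (K : SimpleGraph V) (S : Set V) : SimpleGraph (Option V) :=
  SimpleGraph.fromRel (fun p q =>
    match p, q with
    | some u, some v => K.Adj u v
    | some u, none => u ∈ S
    | _, _ => False)

/-- `G` is (isomorphic to) `H ∘ (e1, e2, a)`: subdivide `e1` and `e2` once each
(with `e1` subdivided twice if `e1 = e2`) and add a new vertex adjacent to `a` and to the
two subdivision vertices. -/
def IsCircOp {V W : Type} (H : SimpleGraph V) (e1 e2 : Sym2 V) (a : V)
    (G : SimpleGraph W) : Prop :=
  (e1 ≠ e2 ∧ ∃ x1 y1 x2 y2 : V, e1 = s(x1, y1) ∧ e2 = s(x2, y2) ∧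
    Nonempty (G ≃g addApex (subdivide (subdivide H x1 y1) (some x2) (some y2))
      {some (some a), some none, none})) ∨
  (e1 = e2 ∧ ∃ x y : V, e1 = s(x, y) ∧
    Nonempty (G ≃g addApex (subdivide (subdivide H x y) none (some y))
      {some (some a), some none, none}))

/-- The cycle of length `n` (for `n ≥ 3`). -/
def cyc (n : ℕ) : SimpleGraph (ZMod n) :=
  SimpleGraph.fromRel (fun u v => v = u + 1)

/-- The families `F_{i,j}` of graphs (closed under isomorphism):
`F_{i,0} = {C_i}` for `i ≥ 3`; `F_{1,1} = {K_4}`; `F_{j,j}` for `j ≥ 2` is obtained from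
`F_{j-1,j-1}` by subdividing one edge once and then applying the `∘` operation at the
subdivision vertex; and `F_{i,j}` for `i > j ≥ 1` is obtained from `F_{j,j}` by `i - j`
successive single-edge subdivisions. -/
inductive MemF : ℕ → ℕ → ∀ {V : Type}, SimpleGraph V → Prop
  | cycle {i : ℕ} (hi : 3 ≤ i) {V : Type} {G : SimpleGraph V}
      (h : Nonempty (G ≃g cyc i)) : MemF i 0 G
  | k4 {V : Type} {G : SimpleGraph V}
      (h : Nonempty (G ≃g (⊤ : SimpleGraph (Fin 4)))) : MemF 1 1 G
  | circ {j : ℕ} (hj : 2 ≤ j) {V : Type} {H : SimpleGraph V}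
      (hH : MemF (j - 1) (j - 1) H) {x y : V} (hxy : H.Adj x y)
      {e1 e2 : Sym2 (Option V)} (he1 : e1 ∈ (subdivide H x y).edgeSet)
      (he2 : e2 ∈ (subdivide H x y).edgeSet)
      {W : Type} {G : SimpleGraph W}
      (hG : IsCircOp (subdivide H x y) e1 e2 none G) : MemF j j G
  | subd {i j : ℕ} (hj : 1 ≤ j) {V : Type} {H : SimpleGraph V}
      (hH : MemF i j H) {x y : V} (hxy : H.Adj x y) {W : Type} {G : SimpleGraph W}
      (hG : Nonempty (G ≃g subdivide H x y)) : MemF (i + 1) j G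

/-- `K_4^+`: the graph obtained from `K_4` by subdividing one edge once. -/
def K4plus : SimpleGraph (Option (Fin 4)) :=
  subdivide (⊤ : SimpleGraph (Fin 4)) 0 1

/-- `L`: the graph obtained from `K_4` by subdividing once each edge
of a perfect matching. -/
def Lgraph : SimpleGraph (Option (Option (Fin 4))) :=
  subdivide (subdivide (⊤ : SimpleGraph (Fin 4)) 0 1) (some 2) (some 3)

/-- The Petersen graph. -/
def petersen : SimpleGraph (ZMod 5 × Fin 2) :=
  SimpleGraph.fromRel (fun u v =>
    (u.2 = 0 ∧ v.2 = 0 ∧ v.1 = u.1 + 1) ∨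
    (u.2 = 1 ∧ v.2 = 1 ∧ v.1 = u.1 + 2) ∨
    (u.2 = 0 ∧ v.2 = 1 ∧ u.1 = v.1))

/-- `R`: the Petersen graph minus one edge. -/
def Rgraph : SimpleGraph (ZMod 5 × Fin 2) :=
  petersen.deleteEdges {s(((0 : ZMod 5), (0 : Fin 2)), ((1 : ZMod 5), (0 : Fin 2)))}

/-- `Q_3`: the 3-dimensional cube graph. -/
def Q3 : SimpleGraph (Fin 2 × Fin 2 × Fin 2) :=
  SimpleGraph.fromRel (fun u v =>
    (u.1 ≠ v.1 ∧ u.2 = v.2) ∨ (u.1 = v.1 ∧ u.2.1 ≠ v.2.1 ∧ u.2.2 = v.2.2) ∨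
    (u.1 = v.1 ∧ u.2.1 = v.2.1 ∧ u.2.2 ≠ v.2.2))

/-- `V_8`: the Wagner graph. -/
def V8 : SimpleGraph (ZMod 8) :=
  SimpleGraph.fromRel (fun u v => v = u + 1 ∨ v = u + 4)

/-- The dodecahedron, presented as the generalized Petersen graph `GP(10,2)`. -/
def dodecahedron : SimpleGraph (ZMod 10 × Fin 2) :=
  SimpleGraph.fromRel (fun u v =>
    (u.2 = 0 ∧ v.2 = 0 ∧ v.1 = u.1 + 1) ∨
    (u.2 = 1 ∧ v.2 = 1 ∧ v.1 = u.1 + 2) ∨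
    (u.2 = 0 ∧ v.2 = 1 ∧ u.1 = v.1))

/-- The families `F^g_{i,j,k}`: 2-connected subcubic graphs obtained from the disjoint
union of `k` copies of `L` (when `g = 4`) or of `R` (when `g = 5`) and one member of
`F_{i,j}` by adding `k+1` edges; when `k ≥ 1`, each added edge joins two different
constituent copies. -/
def MemFG (g i j k : ℕ) {W : Type} (G : SimpleGraph W) : Prop :=
  TwoConnected G ∧ Subcubic G ∧
  ∃ (P : W → Fin (k + 1)) (H : SimpleGraph W),
    H ≤ G ∧ (∀ u v, H.Adj u v → P u = P v) ∧
    MemF i j (H.induce (P ⁻¹' {0})) ∧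
    ((g = 4 ∧ ∀ l : Fin (k + 1), l ≠ 0 → Nonempty ((H.induce (P ⁻¹' {l})) ≃g Lgraph)) ∨
     (g = 5 ∧ ∀ l : Fin (k + 1), l ≠ 0 → Nonempty ((H.induce (P ⁻¹' {l})) ≃g Rgraph))) ∧
    (G.edgeSet \ H.edgeSet).ncard = k + 1 ∧
    (1 ≤ k → ∀ u v, G.Adj u v → ¬ H.Adj u v → P u ≠ P v)

/-- `t_4 = 2/9`, `t_5 = 1/5`. -/
noncomputable def tg (g : ℕ) : ℝ := if g = 4 then 2 / 9 else 1 / 5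

/-- The error function `ε_g` on graphs. -/
noncomputable def eps (g : ℕ) {V : Type} (G : SimpleGraph V) : ℝ := by
  classical
  exact
    if h1 : ∃ p : ℕ × ℕ, 1 ≤ p.1 ∧ p.2 ≤ p.1 ∧ MemF p.1 p.2 G then
      max (1 - (h1.choose.2 : ℝ) * (5 * tg g - 1) - (h1.choose.1 : ℝ) * tg g) 0
    else if h2 : ∃ q : ℕ × ℕ × ℕ, 1 ≤ q.1 ∧ q.2.1 ≤ q.1 ∧ MemFG g q.1 q.2.1 q.2.2 G then
      max (1 - tg g - (h2.choose.2.1 : ℝ) * (5 * tg g - 1) - (h2.choose.1 : ℝ) * tg g) 0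
    else if Nonempty (G ≃g (⊤ : SimpleGraph (Fin 2))) then -tg g
    else 0

/-- The error function `r_g(G)`: the sum of `ε_g(B)` over all blocks `B` of `G`. -/
noncomputable def rg (g : ℕ) {V : Type} (G : SimpleGraph V) : ℝ :=
  ∑ᶠ B ∈ {B : Set V | IsBlock G B}, eps g (G.induce B)

/-- `G` has two vertex-disjoint cycles, each of length less than `g`. -/
def TwoDisjointCyclesLt {V : Type} (G : SimpleGraph V) (g : ℕ) : Prop :=
  ∃ (u v : V) (c1 : G.Walk u u) (c2 : G.Walk v v), c1.IsCycle ∧ c2.IsCycle ∧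
    c1.length < g ∧ c2.length < g ∧ ∀ x, x ∈ c1.support → x ∉ c2.support

/-- `G` contains a (not necessarily induced) subgraph isomorphic to `K`. -/
def ContainsSubgraphCopy {U V : Type} (K : SimpleGraph U) (G : SimpleGraph V) : Prop :=
  ∃ f : U → V, Function.Injective f ∧ ∀ u v, K.Adj u v → G.Adj (f u) (f v)

/-- `G` is obtained from `H` by adding edges, each of which is a cut-edge of `G`. -/
def AddCutEdges {V : Type} (H G : SimpleGraph V) : Prop :=
  H ≤ G ∧ ∀ e ∈ G.edgeSet \ H.edgeSet, G.IsBridge e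

/-- The edges of `H` all lie inside the parts of the partition given by `P`. -/
def PartitionedBy {V ι : Type} (H : SimpleGraph V) (P : V → ι) : Prop :=
  ∀ u v, H.Adj u v → P u = P v

/-- `G` is `g`-minimal: a minimum counterexample to the main theorem. -/
def GMinimal (g : ℕ) {V : Type} [Fintype V] (G : SimpleGraph V) : Prop :=
  Subcubic G ∧ ¬ TwoDisjointCyclesLt G g ∧
  tg g * G.edgeSet.ncard + rg g G < (fvs G : ℝ) ∧
  ∀ (W : Type) [Fintype W] (H : SimpleGraph W), Nat.card W < Nat.card V →
    Subcubic H → ¬ TwoDisjointCyclesLt H g →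
    (fvs H : ℝ) ≤ tg g * H.edgeSet.ncard + rg g H


/-! ### Cores and the inductive property of the families `F_{i,j}` -/

/-- A nonempty set of vertices inducing a subgraph of minimum degree at least 2. -/
def Core {V : Type} (G : SimpleGraph V) (X : Finset V) : Prop :=
  X.Nonempty ∧ ∀ x ∈ X, ∃ a ∈ X, ∃ b ∈ X, a ≠ b ∧ G.Adj x a ∧ G.Adj x b

/-- `S` meets every core. -/
def FV {V : Type} (G : SimpleGraph V) (S : Finset V) : Prop :=
  ∀ X, Core G X → ∃ x ∈ X, x ∈ S

/-- Feedback sets of size `n+1` through each vertex, and of size `n` after removing any edge. -/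
def Good {V : Type} (n : ℕ) (G : SimpleGraph V) : Prop :=
  (∀ v, ∃ S : Finset V, v ∈ S ∧ S.card ≤ n + 1 ∧ FV G S) ∧
  (∀ p q, G.Adj p q → ∃ S : Finset V, S.card ≤ n ∧ FV (G.deleteEdges {s(p, q)}) S)

theorem Core.mono {V : Type} {G H : SimpleGraph V} {X : Finset V} (h : G ≤ H) (hX : Core G X) :
    Core H X := by
  refine ⟨hX.1, fun x hx => ?_⟩
  obtain ⟨a, ha, b, hb, hab, h1, h2⟩ := hX.2 x hx
  exact ⟨a, ha, b, hb, hab, h h1, h h2⟩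

theorem Core.map {V W : Type} {G : SimpleGraph V} {H : SimpleGraph W} {X : Finset V}
    (f : V ↪ W) (h : ∀ u v, G.Adj u v → H.Adj (f u) (f v)) (hX : Core G X) :
    Core H (X.map f) := by
  refine ⟨hX.1.map, fun x hx => ?_⟩
  obtain ⟨u, hu, rfl⟩ := Finset.mem_map.1 hx
  obtain ⟨a, ha, b, hb, hab, h1, h2⟩ := hX.2 u hu
  exact ⟨f a, Finset.mem_map_of_mem f ha, f b, Finset.mem_map_of_mem f hb,
    fun e => hab (f.injective e), h _ _ h1, h _ _ h2⟩

theorem FV.iso {V W : Type} {G : SimpleGraph V} {H : SimpleGraph W} (e : V ≃ W)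
    (h : ∀ u v, G.Adj u v → H.Adj (e u) (e v)) {S : Finset W} (hS : FV H S) :
    FV G (S.map e.symm.toEmbedding) := by
  intro X hX
  obtain ⟨x, hx, hxS⟩ := hS _ (hX.map e.toEmbedding h)
  obtain ⟨u, hu, rfl⟩ := Finset.mem_map.1 hx
  exact ⟨u, hu, Finset.mem_map.2 ⟨_, hxS, by simp⟩⟩

theorem Good.iso {V W : Type} {G : SimpleGraph V} {H : SimpleGraph W} {n : ℕ} (e : G ≃g H)
    (hH : Good n H) : Good n G := by
  refine ⟨fun v => ?_, fun p q hpq => ?_⟩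
  · obtain ⟨S, hv, hc, hS⟩ := hH.1 (e v)
    refine ⟨_, Finset.mem_map.2 ⟨_, hv, ?_⟩, ?_, hS.iso e.toEquiv (fun u v h => e.map_adj_iff.2 h)⟩
    · exact e.symm_apply_apply v
    · simpa using hc
  · obtain ⟨S, hc, hS⟩ := hH.2 (e p) (e q) (e.map_adj_iff.2 hpq)
    refine ⟨_, ?_, hS.iso e.toEquiv ?_⟩
    · simpa using hc
    · intro u v h
      simp only [deleteEdges_adj, Set.mem_singleton_iff] at h ⊢
      refine ⟨e.map_adj_iff.2 h.1, fun h2 => h.2 ?_⟩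
      have h3 : Sym2.map e s(u, v) = Sym2.map e s(p, q) := h2
      exact Sym2.map.injective e.injective h3

section adj
variable {V : Type} (H : SimpleGraph V) (x y u v : V)

theorem sub_ss : (subdivide H x y).Adj (some u) (some v) ↔ H.Adj u v ∧ s(u, v) ≠ s(x, y) := by
  simp only [subdivide, SimpleGraph.fromRel_adj]
  constructor
  · rintro ⟨_, h | h⟩
    · exact h
    · exact ⟨h.1.symm, by rw [Sym2.eq_swap]; exact h.2⟩
  · intro h
    exact ⟨fun e => h.1.ne (Option.some.inj e), Or.inl h⟩

theorem sub_sn : (subdivide H x y).Adj (some u) none ↔ u = x ∨ u = y := by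
  simp [subdivide, SimpleGraph.fromRel_adj]

theorem sub_ns : (subdivide H x y).Adj none (some u) ↔ u = x ∨ u = y := by
  simp [subdivide, SimpleGraph.fromRel_adj]

theorem apex_ss (T : Set V) : (addApex H T).Adj (some u) (some v) ↔ H.Adj u v := by
  simp only [addApex, SimpleGraph.fromRel_adj]
  constructor
  · rintro ⟨_, h | h⟩
    · exact h
    · exact h.symm
  · intro h
    exact ⟨fun e => h.ne (Option.some.inj e), Or.inl h⟩

theorem apex_sn (T : Set V) : (addApex H T).Adj (some u) none ↔ u ∈ T := by
  simp [addApex, SimpleGraph.fromRel_adj]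

theorem apex_ns (T : Set V) : (addApex H T).Adj none (some u) ↔ u ∈ T := by
  simp [addApex, SimpleGraph.fromRel_adj]

end adj

theorem core_erase {V : Type} {K : SimpleGraph (Option V)} {H : SimpleGraph V}
    {X : Finset (Option V)} (hss : ∀ u v, K.Adj (some u) (some v) → H.Adj u v) (hn : none ∉ X)
    (hX : Core K X) : Core H X.eraseNone := by
  obtain ⟨⟨z, hz⟩, hX⟩ := hX
  refine ⟨?_, fun u hu => ?_⟩
  · cases z with
    | none => exact absurd hz hn
    | some z => exact ⟨z, by simpa using hz⟩
  · obtain ⟨a, ha, b, hb, hab, h1, h2⟩ := hX (some u) (by simpa using hu)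
    cases a with
    | none => exact absurd ha hn
    | some a =>
      cases b with
      | none => exact absurd hb hn
      | some b =>
        exact ⟨a, by simpa using ha, b, by simpa using hb, fun e => hab (by rw [e]),
          hss _ _ h1, hss _ _ h2⟩

theorem core_sub {V : Type} {K : SimpleGraph (Option V)} {H : SimpleGraph V} {x y : V}
    {X : Finset (Option V)} (hxy : H.Adj x y)
    (hss : ∀ u v, K.Adj (some u) (some v) → H.Adj u v ∧ s(u, v) ≠ s(x, y))
    (hsn : ∀ u, K.Adj (some u) none → u = x ∨ u = y)
    (hX : Core K X) : Core H X.eraseNone := by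
  by_cases hn : none ∈ X
  swap
  · exact core_erase (fun u v h => (hss u v h).1) hn hX
  obtain ⟨_, hX⟩ := hX
  have key : some x ∈ X ∧ some y ∈ X := by
    obtain ⟨a, ha, b, hb, hab, h1, h2⟩ := hX none hn
    cases a with
    | none => exact absurd h1 (K.loopless.irrefl _)
    | some a =>
      cases b with
      | none => exact absurd h2 (K.loopless.irrefl _)
      | some b =>
        have := hsn a h1.symm
        have := hsn b h2.symm
        grind
  have step : ∀ u, some u ∈ X → ∀ c ∈ X, ∀ b, K.Adj (some u) c → K.Adj (some u) (some b) →
      c ≠ some b → ∃ a, some a ∈ X ∧ a ≠ b ∧ H.Adj u a := by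
    intro u hu c hc b h1 h2 hne
    cases c with
    | some c => exact ⟨c, hc, fun e => hne (by rw [e]), (hss _ _ h1).1⟩
    | none =>
      rcases hsn u h1 with rfl | rfl
      · exact ⟨y, key.2, fun e => (hss _ _ h2).2 (by rw [e]), hxy⟩
      · exact ⟨x, key.1, fun e => (hss _ _ h2).2 (by rw [e, Sym2.eq_swap]), hxy.symm⟩
  refine ⟨⟨x, by simpa using key.1⟩, fun u hu => ?_⟩
  have hu' : some u ∈ X := by simpa using hu
  obtain ⟨a, ha, b, hb, hab, h1, h2⟩ := hX (some u) hu'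
  cases b with
  | some b =>
    obtain ⟨c, hc, hcb, h⟩ := step u hu' a ha b h1 h2 hab
    exact ⟨c, by simpa using hc, b, by simpa using hb, hcb, h, (hss _ _ h2).1⟩
  | none =>
    cases a with
    | none => exact absurd rfl hab
    | some a =>
      obtain ⟨c, hc, hcb, h⟩ := step u hu' none hb a h2 h1 hab.symm
      exact ⟨c, by simpa using hc, a, by simpa using ha, hcb, h, (hss _ _ h1).1⟩

theorem Good.subdivide {V : Type} {H : SimpleGraph V} {n : ℕ} {x y : V} (hH : Good n H)
    (hxy : H.Adj x y) : Good n (subdivide H x y) := by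
  classical
  refine ⟨fun v => ?_, ?_⟩
  · cases v with
    | none =>
      obtain ⟨S, hc, hS⟩ := hH.2 x y hxy
      refine ⟨Finset.insertNone S, by simp, by simpa using hc, fun X hX => ?_⟩
      by_contra hcon
      push Not at hcon
      have hn : none ∉ X := fun h => hcon none h (by simp)
      obtain ⟨z, hz, hzS⟩ := hS X.eraseNone (core_erase (fun u v h => by
        rw [sub_ss] at h; simpa [deleteEdges_adj] using h) hn hX)
      exact hcon (some z) (by simpa using hz) (by simpa using hzS)
    | some v =>
      obtain ⟨S, hv, hc, hS⟩ := hH.1 v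
      refine ⟨S.map Function.Embedding.some, by simpa using hv, by simpa using hc,
        fun X hX => ?_⟩
      obtain ⟨z, hz, hzS⟩ := hS X.eraseNone (core_sub hxy (fun u v h => (sub_ss H x y u v).1 h)
        (fun u h => (sub_sn H x y u).1 h) hX)
      exact ⟨some z, by simpa using hz, by simpa using hzS⟩
  · have half : ∀ w, w = x ∨ w = y → ∃ S : Finset (Option V), S.card ≤ n ∧
        FV ((InducedForest.subdivide H x y).deleteEdges {s(some w, none)}) S := by
      intro w hw
      obtain ⟨S, hc, hS⟩ := hH.2 x y hxy
      refine ⟨S.map Function.Embedding.some, by simpa using hc, fun X hX => ?_⟩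
      have hn : none ∉ X := by
        intro hn
        obtain ⟨a, ha, b, hb, hab, h1, h2⟩ := hX.2 none hn
        rw [deleteEdges_adj] at h1 h2
        cases a with
        | none => exact absurd h1.1 (SimpleGraph.irrefl _)
        | some a =>
          cases b with
          | none => exact absurd h2.1 (SimpleGraph.irrefl _)
          | some b =>
            have h3 := (sub_ns H x y a).1 h1.1
            have h4 := (sub_ns H x y b).1 h2.1
            have h5 : a ≠ w := fun e => h1.2 (by simp [e, Sym2.eq_swap])
            have h6 : b ≠ w := fun e => h2.2 (by simp [e, Sym2.eq_swap])
            grind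
      obtain ⟨z, hz, hzS⟩ := hS X.eraseNone (core_erase (fun u v h => by
        rw [deleteEdges_adj, sub_ss] at h; simpa [deleteEdges_adj] using h.1) hn hX)
      exact ⟨some z, by simpa using hz, by simpa using hzS⟩
    intro p q hpq
    cases p with
    | none =>
      cases q with
      | none => exact absurd hpq (SimpleGraph.irrefl _)
      | some q =>
        rw [Sym2.eq_swap]
        exact half q ((sub_ns H x y q).1 hpq)
    | some p =>
      cases q with
      | none => exact half p ((sub_sn H x y p).1 hpq)
      | some q =>
        rw [sub_ss] at hpq
        obtain ⟨S, hc, hS⟩ := hH.2 p q hpq.1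
        refine ⟨S.map Function.Embedding.some, by simpa using hc, fun X hX => ?_⟩
        suffices hcore : Core (H.deleteEdges {s(p, q)}) X.eraseNone by
          obtain ⟨z, hz, hzS⟩ := hS X.eraseNone hcore
          exact ⟨some z, by simpa using hz, by simpa using hzS⟩
        refine core_sub (x := x) (y := y) ?_ ?_ ?_ hX
        · rw [deleteEdges_adj]
          exact ⟨hxy, fun h => hpq.2 (by simpa using h.symm)⟩
        · intro u v h
          rw [deleteEdges_adj, sub_ss] at h
          rw [deleteEdges_adj]
          refine ⟨⟨h.1.1, fun h2 => h.2 ?_⟩, h.1.2⟩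
          have h3 : s(u, v) = s(p, q) := h2
          have := congrArg (Sym2.map some) h3
          simpa using this
        · intro u h
          rw [deleteEdges_adj, sub_sn] at h
          exact h.1

theorem Good.apex {V : Type} {K : SimpleGraph V} {n : ℕ} (a b c : V) (hK : Good n K) :
    Good (n + 1) (addApex K {a, b, c}) := by
  classical
  refine ⟨?_, ?_⟩
  · have key : ∀ v : V, ∃ S : Finset (Option V), some v ∈ S ∧ none ∈ S ∧ S.card ≤ n + 1 + 1 ∧
        FV (addApex K {a, b, c}) S := by
      intro v
      obtain ⟨S, hv, hc, hS⟩ := hK.1 v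
      refine ⟨Finset.insertNone S, by simpa using hv, by simp, by simpa using hc,
        fun X hX => ?_⟩
      by_contra hcon
      push Not at hcon
      have hn : none ∉ X := fun h => hcon none h (by simp)
      obtain ⟨z, hz, hzS⟩ := hS X.eraseNone (core_erase (fun u v h => by
        rwa [apex_ss] at h) hn hX)
      exact hcon (some z) (by simpa using hz) (by simpa using hzS)
    intro v
    cases v with
    | none => obtain ⟨S, h1, h2⟩ := key a; exact ⟨S, h2⟩
    | some v => obtain ⟨S, h1, _, h2⟩ := key v; exact ⟨S, h1, h2⟩
  · have half : ∀ w, w ∈ ({a, b, c} : Set V) → ∃ S : Finset (Option V), S.card ≤ n + 1 ∧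
        FV ((addApex K {a, b, c}).deleteEdges {s(some w, none)}) S := by
      intro w hw
      obtain ⟨w1, w2, hw12⟩ : ∃ w1 w2, ∀ z ∈ ({a, b, c} : Set V), z ≠ w → z = w1 ∨ z = w2 := by
        simp only [Set.mem_insert_iff, Set.mem_singleton_iff] at hw ⊢
        rcases hw with rfl | rfl | rfl
        · exact ⟨b, c, by grind⟩
        · exact ⟨a, c, by grind⟩
        · exact ⟨a, b, by grind⟩
      obtain ⟨S, hv, hc, hS⟩ := hK.1 w1
      refine ⟨S.map Function.Embedding.some, by simpa using hc, fun X hX => ?_⟩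
      by_cases hn : none ∈ X
      · obtain ⟨p, hp, q, hq, hpq, h1, h2⟩ := hX.2 none hn
        rw [deleteEdges_adj] at h1 h2
        cases p with
        | none => exact absurd h1.1 (SimpleGraph.irrefl _)
        | some p =>
          cases q with
          | none => exact absurd h2.1 (SimpleGraph.irrefl _)
          | some q =>
            have h3 := (apex_ns _ _ _).1 h1.1
            have h4 := (apex_ns _ _ _).1 h2.1
            have h5 : p ≠ w := fun e => h1.2 (by simp [e, Sym2.eq_swap])
            have h6 : q ≠ w := fun e => h2.2 (by simp [e, Sym2.eq_swap])
            rcases hw12 p h3 h5 with rfl | rfl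
            · exact ⟨some p, hp, by simpa using hv⟩
            · rcases hw12 q h4 h6 with rfl | rfl
              · exact ⟨some q, hq, by simpa using hv⟩
              · exact absurd rfl hpq
      · obtain ⟨z, hz, hzS⟩ := hS X.eraseNone (core_erase (fun u v h => by
          rw [deleteEdges_adj, apex_ss] at h; exact h.1) hn hX)
        exact ⟨some z, by simpa using hz, by simpa using hzS⟩
    intro p q hpq
    cases p with
    | none =>
      cases q with
      | none => exact absurd hpq (SimpleGraph.irrefl _)
      | some q =>
        rw [Sym2.eq_swap]
        exact half q ((apex_ns _ _ _).1 hpq)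
    | some p =>
      cases q with
      | none => exact half p ((apex_sn _ _ _).1 hpq)
      | some q =>
        rw [apex_ss] at hpq
        obtain ⟨S, hc, hS⟩ := hK.2 p q hpq
        refine ⟨Finset.insertNone S, by simpa using hc, fun X hX => ?_⟩
        by_contra hcon
        push Not at hcon
        have hn : none ∉ X := fun h => hcon none h (by simp)
        obtain ⟨z, hz, hzS⟩ := hS X.eraseNone (core_erase (fun u v h => by
          rw [deleteEdges_adj, apex_ss] at h
          rw [deleteEdges_adj]
          refine ⟨h.1, fun h2 => h.2 ?_⟩
          have h3 : s(u, v) = s(p, q) := h2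
          have := congrArg (Sym2.map some) h3
          simpa using this) hn hX)
        exact hcon (some z) (by simpa using hz) (by simpa using hzS)

theorem good_cyc {n : ℕ} (hn : 3 ≤ n) : Good 0 (cyc n) := by
  classical
  have : NeZero n := ⟨by omega⟩
  have hadj : ∀ u v : ZMod n, (cyc n).Adj u v → v = u + 1 ∨ v = u - 1 := by
    intro u v h
    simp only [cyc, SimpleGraph.fromRel_adj] at h
    rcases h.2 with h | h
    · exact Or.inl h
    · right; rw [h]; ring
  have hall : ∀ X : Finset (ZMod n), Core (cyc n) X → ∀ x, x ∈ X := by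
    rintro X ⟨⟨z, hz⟩, hX⟩ x
    have hs : ∀ u ∈ X, u + 1 ∈ X := by
      intro u hu
      obtain ⟨a, ha, b, hb, hab, h1, h2⟩ := hX u hu
      have h1 := hadj _ _ h1
      have h2 := hadj _ _ h2
      grind
    have hm : ∀ m : ℕ, z + m ∈ X := by
      intro m
      induction m with
      | zero => simpa using hz
      | succ m ih => have := hs _ ih; push_cast; rwa [← add_assoc]
    have := hm (x - z).val
    rw [ZMod.natCast_zmod_val] at this
    simpa using this
  refine ⟨fun v => ⟨{v}, by simp, by simp, fun X hX => ⟨v, hall X hX v, by simp⟩⟩, ?_⟩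
  intro p q hpq
  refine ⟨∅, by simp, fun X hX => ?_⟩
  exfalso
  have hp := hall X (hX.mono (deleteEdges_le _)) p
  obtain ⟨a, ha, b, hb, hab, h1, h2⟩ := hX.2 p hp
  rw [deleteEdges_adj] at h1 h2
  have h5 : a ≠ q := fun e => h1.2 (by simp [e])
  have h6 : b ≠ q := fun e => h2.2 (by simp [e])
  have h1 := hadj _ _ h1.1
  have h2 := hadj _ _ h2.1
  have h3 := hadj _ _ hpq
  grind

theorem good_k4 : Good 1 (⊤ : SimpleGraph (Fin 4)) := by
  have three : ∀ X : Finset (Fin 4), ∀ x ∈ X, ∀ a ∈ X, ∀ b ∈ X, x ≠ a → x ≠ b → a ≠ b →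
      ∀ v w : Fin 4, v ≠ w → v ∈ X ∨ w ∈ X := by decide
  refine ⟨fun v => ⟨{v, v + 1}, by simp, Finset.card_le_two, ?_⟩, ?_⟩
  · intro X hX
    obtain ⟨⟨x, hx⟩, hX⟩ := hX
    obtain ⟨a, ha, b, hb, hab, h1, h2⟩ := hX x hx
    rcases three X x hx a ha b hb h1 h2 hab v (v + 1) (by revert v; decide) with h | h
    · exact ⟨v, h, by simp⟩
    · exact ⟨v + 1, h, by simp⟩
  · intro p q hpq
    obtain ⟨w, hwp, hwq⟩ : ∃ w : Fin 4, w ≠ p ∧ w ≠ q := by revert p q; decide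
    refine ⟨{w}, by simp, fun X hX => ?_⟩
    by_contra hcon
    have hw : w ∉ X := by simpa using hcon
    obtain ⟨⟨x, hx⟩, hX⟩ := hX
    obtain ⟨a, ha, b, hb, hab, h1, h2⟩ := hX x hx
    rw [deleteEdges_adj] at h1 h2
    have h3 := three X x hx a ha b hb h1.1 h2.1 hab w p hwp
    have hp : p ∈ X := by tauto
    obtain ⟨a', ha', b', hb', hab', h1', h2'⟩ := hX p hp
    rw [deleteEdges_adj] at h1' h2'
    have h5 : a' ≠ q := fun e => h1'.2 (by simp [e])
    have h6 : b' ≠ q := fun e => h2'.2 (by simp [e])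
    have h7 := h1'.1
    have h8 := h2'.1
    simp only [top_adj] at h7 h8 hpq
    have : ∀ p q a' b' w : Fin 4, p ≠ q → a' ≠ q → b' ≠ q → a' ≠ b' → p ≠ a' → p ≠ b' →
      w ≠ p → w ≠ q → w = a' ∨ w = b' := by decide
    rcases this p q a' b' w hpq h5 h6 hab' h7 h8 hwp hwq with rfl | rfl
    · exact hw ha'
    · exact hw hb'

/-! ### Vertex and edge counts -/

theorem iso_edges {V W : Type} {G : SimpleGraph V} {H : SimpleGraph W} (e : G ≃g H) :
    G.edgeSet.ncard = H.edgeSet.ncard := by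
  rw [← Nat.card_coe_set_eq, ← Nat.card_coe_set_eq]
  exact Nat.card_congr e.mapEdgeSet

theorem edges_option {V : Type} [Finite V] {K : SimpleGraph (Option V)} (A : Set (Sym2 V))
    (hA : ∀ u v, s(u, v) ∈ A → K.Adj (some u) (some v)) (T : Finset V)
    (hT : ∀ t ∈ T, K.Adj (some t) none) : A.ncard + T.card ≤ K.edgeSet.ncard := by
  classical
  have hi1 : Function.Injective (Sym2.map (some : V → Option V)) :=
    Sym2.map.injective (Option.some_injective V)
  have hi2 : Function.Injective (fun t : V => s(some t, (none : Option V))) := by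
    intro a b h
    simpa using h
  have h1 : (Sym2.map some '' A).ncard = A.ncard := Set.ncard_image_of_injective _ hi1
  have h2 : ((fun t : V => s(some t, (none : Option V))) '' (T : Set V)).ncard = T.card := by
    rw [Set.ncard_image_of_injective _ hi2, Set.ncard_coe_finset]
  rw [← h1, ← h2, ← Set.ncard_union_eq ?_ (Set.toFinite _) (Set.toFinite _)]
  · apply Set.ncard_le_ncard _ (Set.toFinite _)
    rintro e (⟨f, hf, rfl⟩ | ⟨t, ht, rfl⟩)
    · induction f with
      | _ u v => exact hA u v hf
    · exact hT t ht
  · rw [Set.disjoint_left]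
    rintro e ⟨f, hf, rfl⟩ ⟨t, ht, h⟩
    induction f with
    | _ u v => simp at h

theorem edges_subdivide {V : Type} [Finite V] {H : SimpleGraph V} {x y : V} (hxy : H.Adj x y) :
    H.edgeSet.ncard + 1 ≤ (subdivide H x y).edgeSet.ncard := by
  classical
  have := edges_option (K := subdivide H x y) (H.edgeSet \ {s(x, y)})
    (fun u v h => (sub_ss H x y u v).2 ⟨h.1, h.2⟩) {x, y}
    (fun t ht => (sub_sn H x y t).2 (by simpa using ht))
  rw [Finset.card_pair hxy.ne] at this
  have h2 := Set.ncard_sdiff_singleton_add_one (s := H.edgeSet) (a := s(x, y)) hxy (Set.toFinite _)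
  omega

theorem edges_apex {V : Type} [Finite V] {H : SimpleGraph V} {a b c : V} (hab : a ≠ b)
    (hac : a ≠ c) (hbc : b ≠ c) :
    H.edgeSet.ncard + 3 ≤ (addApex H {a, b, c}).edgeSet.ncard := by
  classical
  have := edges_option (K := addApex H {a, b, c}) H.edgeSet
    (fun u v h => (apex_ss H u v _).2 h) {a, b, c}
    (fun t ht => (apex_sn H t _).2 (by simpa using ht))
  rwa [Finset.card_eq_three.2 ⟨a, b, c, hab, hac, hbc, rfl⟩] at this

theorem edges_cyc {n : ℕ} (hn : 3 ≤ n) : n ≤ (cyc n).edgeSet.ncard := by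
  have : NeZero n := ⟨by omega⟩
  have : Fact (1 < n) := ⟨by omega⟩
  have h2 : (2 : ZMod n) ≠ 0 := by
    intro h
    have h' : ((2 : ℕ) : ZMod n) = 0 := by exact_mod_cast h
    rw [ZMod.natCast_eq_zero_iff] at h'
    have := Nat.le_of_dvd (by norm_num) h'
    omega
  have hinj : Function.Injective (fun u : ZMod n => s(u, u + 1)) := by
    intro u v h
    simp only [Sym2.eq_iff] at h
    rcases h with h | ⟨h, h'⟩
    · exact h.1
    · exfalso
      apply h2
      rw [h] at h'
      have : v + 1 + 1 - v = 0 := by rw [h']; ring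
      rw [← this]; ring
  have h1 : (Set.range (fun u : ZMod n => s(u, u + 1))).ncard = n := by
    rw [← Set.image_univ, Set.ncard_image_of_injective _ hinj, Set.ncard_univ, Nat.card_zmod]
  have h3 := Set.ncard_le_ncard (s := Set.range (fun u : ZMod n => s(u, u + 1)))
    (t := (cyc n).edgeSet) (by rintro _ ⟨u, rfl⟩; simp [cyc, SimpleGraph.fromRel_adj])
    (Set.toFinite _)
  omega

theorem edges_k4 : 6 ≤ (⊤ : SimpleGraph (Fin 4)).edgeSet.ncard := by
  have h := card_edgeFinset_top_eq_card_choose_two (V := Fin 4)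
  rw [← SimpleGraph.coe_edgeFinset, Set.ncard_coe_finset, h]
  decide

theorem memF_all {i j : ℕ} {V : Type} {G : SimpleGraph V} (h : MemF i j G) :
    Good j G ∧ Finite V ∧ Nat.card V = i + 3 * j ∧ i + 5 * j ≤ G.edgeSet.ncard ∧ 1 ≤ i := by
  induction h with
  | @cycle i hi V G h =>
    obtain ⟨e⟩ := h
    have : NeZero i := ⟨by omega⟩
    refine ⟨(good_cyc hi).iso e, Finite.of_equiv _ e.toEquiv.symm, ?_, ?_, by omega⟩
    · rw [Nat.card_congr e.toEquiv, Nat.card_zmod]; rfl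
    · rw [iso_edges e]; exact edges_cyc hi
  | @k4 V G h =>
    obtain ⟨e⟩ := h
    refine ⟨good_k4.iso e, Finite.of_equiv _ e.toEquiv.symm, ?_, ?_, by omega⟩
    · rw [Nat.card_congr e.toEquiv]; simp
    · rw [iso_edges e]; exact edges_k4
  | @circ j hj V H hH x y hxy e1 e2 he1 he2 W G hG ih =>
    obtain ⟨ihg, ihf, ihv, ihe, -⟩ := ih
    have hK := ihg.subdivide hxy
    have hKe := edges_subdivide hxy
    have main : ∀ (x1 y1 : Option V) (x2 y2 : Option (Option V)),
        (subdivide H x y).Adj x1 y1 → (subdivide (subdivide H x y) x1 y1).Adj x2 y2 →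
        ∀ e : G ≃g addApex (subdivide (subdivide (subdivide H x y) x1 y1) x2 y2)
          {some (some none), some none, none},
        Good j G ∧ Finite W ∧ Nat.card W = j + 3 * j ∧ j + 5 * j ≤ G.edgeSet.ncard ∧ 1 ≤ j := by
      intro x1 y1 x2 y2 h1 h2 e
      have hgood := ((hK.subdivide h1).subdivide h2).apex (some (some none)) (some none) none
      have hj' : j - 1 + 1 = j := by omega
      rw [hj'] at hgood
      have hE1 := edges_subdivide h1
      have hE2 := edges_subdivide h2
      have hE3 := edges_apex (H := subdivide (subdivide (subdivide H x y) x1 y1) x2 y2)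
        (a := some (some none)) (b := some none) (c := none) (by simp) (by simp) (by simp)
      refine ⟨hgood.iso e, Finite.of_equiv _ e.toEquiv.symm, ?_, ?_, by omega⟩
      · rw [Nat.card_congr e.toEquiv]
        simp only [Finite.card_option]
        omega
      · rw [iso_edges e]; omega
    rcases hG with ⟨hne, x1, y1, x2, y2, rfl, rfl, ⟨e⟩⟩ | ⟨rfl, x1, y1, rfl, ⟨e⟩⟩
    · exact main x1 y1 (some x2) (some y2) he1 ((sub_ss _ _ _ _ _).2 ⟨he2, hne.symm⟩) e
    · exact main x1 y1 none (some y1) he1 ((sub_ns _ _ _ _).2 (Or.inr rfl)) e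
  | @subd i j hj V H hH x y hxy W G hG ih =>
    obtain ⟨ihg, ihf, ihv, ihe, ihi⟩ := ih
    obtain ⟨e⟩ := hG
    have hE := edges_subdivide hxy
    refine ⟨(ihg.subdivide hxy).iso e, Finite.of_equiv _ e.toEquiv.symm, ?_, ?_, by omega⟩
    · rw [Nat.card_congr e.toEquiv, Finite.card_option]; omega
    · rw [iso_edges e]; omega

theorem memF_L : MemF 3 1 Lgraph := by
  refine MemF.subd (i := 2) le_rfl (MemF.subd (i := 1) le_rfl (MemF.k4 ⟨Iso.refl⟩)
    (x := (0 : Fin 4)) (y := 1) (by simp) ⟨Iso.refl⟩) (x := some 2) (y := some 3) ?_ ⟨Iso.refl⟩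
  rw [sub_ss]
  exact ⟨by simp, by decide⟩

/-! ### Cycles, connectivity and gluing -/

theorem cycle_nbrs {V : Type} {G : SimpleGraph V} {u : V} {c : G.Walk u u} (hc : c.IsCycle)
    {x : V} (hx : x ∈ c.support) :
    ∃ a b, a ≠ b ∧ s(x, a) ∈ c.edges ∧ s(x, b) ∈ c.edges := by
  have h := hc.ncard_neighborSet_toSubgraph_eq_two hx
  obtain ⟨a, b, hab, h⟩ := Set.ncard_eq_two.1 h
  have ha : a ∈ c.toSubgraph.neighborSet x := by rw [h]; simp
  have hb : b ∈ c.toSubgraph.neighborSet x := by rw [h]; simp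
  refine ⟨a, b, hab, ?_, ?_⟩
  · exact Walk.mem_edges_toSubgraph c |>.1 ha
  · exact Walk.mem_edges_toSubgraph c |>.1 hb

theorem isFVS_of_cycles {V : Type} {G : SimpleGraph V} {S : Set V}
    (h : ∀ (u : V) (c : G.Walk u u), c.IsCycle → ∃ x ∈ c.support, x ∈ S) : IsFVS G S := by
  intro u c hc
  obtain ⟨x, hx, hxS⟩ := h _ (c.map (Embedding.induce Sᶜ).toHom)
    (hc.map (Embedding.induce (G := G) Sᶜ).injective)
  rw [Walk.support_map, List.mem_map] at hx
  obtain ⟨y, -, rfl⟩ := hx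
  exact y.2 hxS

theorem FV.isFVS {V : Type} {G : SimpleGraph V} {S : Finset V} (h : FV G S) :
    IsFVS G (S : Set V) := by
  classical
  refine isFVS_of_cycles fun u c hc => ?_
  obtain ⟨x, hx, hxS⟩ := h c.support.toFinset ⟨⟨u, by simp⟩, fun x hx => by
    obtain ⟨a, b, hab, ha, hb⟩ := cycle_nbrs hc (List.mem_toFinset.1 hx)
    exact ⟨a, List.mem_toFinset.2 (c.snd_mem_support_of_mem_edges ha), b,
      List.mem_toFinset.2 (c.snd_mem_support_of_mem_edges hb), hab,
      c.adj_of_mem_edges ha, c.adj_of_mem_edges hb⟩⟩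
  exact ⟨x, List.mem_toFinset.1 hx, hxS⟩

theorem two_conn_edge {V : Type} [Finite V] {G : SimpleGraph V} (h : TwoConnected G) {a b : V}
    (hab : G.Adj a b) : (G.deleteEdges {s(a, b)}).Connected := by
  have hconn : G.Connected := by
    have := h.2 ∅ (by simp)
    rw [Set.compl_empty] at this
    exact (induceUnivIso G).connected_iff.1 this
  apply hconn.connected_delete_edge_of_not_isBridge
  rw [isBridge_iff, not_not]
  have hc : ∃ c, c ≠ a ∧ c ≠ b := by
    by_contra! hc
    have : (Set.univ : Set V) ⊆ {a, b} := by
      intro x _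
      by_cases hx : x = a
      · simp [hx]
      · simp [hc x hx]
    have h1 := Set.ncard_le_ncard this
    rw [Set.ncard_univ] at h1
    have := Set.ncard_pair hab.ne
    have := h.1
    omega
  obtain ⟨c, hca, hcb⟩ := hc
  have h1 := (h.2 {b} (by simp)).preconnected ⟨a, by simpa using hab.ne⟩ ⟨c, by simpa using hcb⟩
  obtain ⟨d, hd⟩ : ∃ d : ({b}ᶜ : Set V), G.Adj a d := by
    obtain ⟨p⟩ := h1
    cases p with
    | nil => exact absurd rfl hca
    | cons h p => exact ⟨_, h⟩
  have hdb : (d : V) ≠ b := d.2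
  have h2 := (h.2 {a} (by simp)).preconnected ⟨d, by simpa using hd.ne'⟩
    ⟨b, by simpa using hab.ne'⟩
  have h3 : (G.deleteEdges {s(a, b)}).Reachable d b := by
    refine h2.map (G' := G.deleteEdges {s(a, b)}) ⟨Subtype.val, ?_⟩
    intro x y hxy
    rw [deleteEdges_adj]
    refine ⟨hxy, ?_⟩
    have hx : (x : V) ≠ a := x.2
    have hy : (y : V) ≠ a := y.2
    simp [hx, hy]
  refine Reachable.trans (Adj.reachable ?_) h3
  rw [deleteEdges_adj]
  refine ⟨hd, ?_⟩
  simp [hdb, hd.ne']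

theorem quotient_bound {W : Type} [Finite W] {K H : SimpleGraph W} {k : ℕ} {P : W → Fin (k + 1)}
    (hP : Function.Surjective P) (hH : ∀ u v, H.Adj u v → P u = P v) (hK : K.Connected) :
    k ≤ (K.edgeSet \ H.edgeSet).ncard := by
  let Q : SimpleGraph (Fin (k + 1)) :=
    SimpleGraph.fromRel (fun l m => ∃ u v, P u = l ∧ P v = m ∧ K.Adj u v)
  have hr : ∀ u v, K.Reachable u v → Q.Reachable (P u) (P v) := by
    rintro u v ⟨p⟩
    induction p with
    | nil => exact Reachable.refl _
    | @cons a b c h p ih =>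
      refine Reachable.trans ?_ ih
      by_cases hab : P a = P b
      · rw [hab]
      · exact Adj.reachable ((SimpleGraph.fromRel_adj _ _ _).2 ⟨hab, Or.inl ⟨a, b, rfl, rfl, h⟩⟩)
  have hQ : Q.Connected := by
    refine ⟨fun l m => ?_⟩
    obtain ⟨u, rfl⟩ := hP l
    obtain ⟨v, rfl⟩ := hP m
    exact hr u v (hK.preconnected u v)
  have h1 := hQ.card_vert_le_card_edgeSet_add_one
  rw [Nat.card_coe_set_eq] at h1
  have h2 : Q.edgeSet ⊆ Sym2.map P '' (K.edgeSet \ H.edgeSet) := by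
    intro e he
    induction e with
    | _ l m =>
      have key : ∀ l m, l ≠ m → (∃ u v, P u = l ∧ P v = m ∧ K.Adj u v) →
          s(l, m) ∈ Sym2.map P '' (K.edgeSet \ H.edgeSet) := by
        rintro _ _ hne ⟨u, v, rfl, rfl, h⟩
        exact ⟨s(u, v), ⟨h, fun h' => hne (hH _ _ h')⟩, by simp⟩
      have he' := (SimpleGraph.fromRel_adj _ l m).1 (show Q.Adj l m from he)
      rcases he'.2 with h | h
      · exact key _ _ he'.1 h
      · rw [Sym2.eq_swap]; exact key _ _ he'.1.symm h
  have h3 := Set.ncard_le_ncard h2 (Set.toFinite _)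
  have h4 := Set.ncard_image_le (f := Sym2.map P) (Set.toFinite (K.edgeSet \ H.edgeSet))
  simp at h1
  omega

theorem glue {W : Type} [Finite W] {G H : SimpleGraph W} {k : ℕ} {P : W → Fin (k + 1)}
    (hP : Function.Surjective P) (hH : ∀ u v, H.Adj u v → P u = P v) (h2 : TwoConnected G)
    (hcard : (G.edgeSet \ H.edgeSet).ncard = k + 1)
    (hd : ∀ u v, G.Adj u v → ¬ H.Adj u v → P u ≠ P v) (n : Fin (k + 1) → ℕ)
    (hn : ∀ l, ∀ v : (P ⁻¹' {l} : Set W), ∃ S : Finset (P ⁻¹' {l} : Set W),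
      v ∈ S ∧ S.card ≤ n l ∧ FV (H.induce (P ⁻¹' {l})) S) (v : W) :
    ∃ S : Finset W, v ∈ S ∧ S.card ≤ ∑ l, n l ∧ IsFVS G (S : Set W) := by
  classical
  obtain ⟨e0, he0⟩ : (G.edgeSet \ H.edgeSet).Nonempty := by
    apply Set.nonempty_of_ncard_ne_zero; omega
  obtain ⟨a, w, rfl, hwv⟩ : ∃ a w, e0 = s(a, w) ∧ P w ≠ P v := by
    induction e0 with
    | _ a b =>
      have hab := hd a b he0.1 he0.2
      by_cases hb : P b = P v
      · exact ⟨b, a, Sym2.eq_swap, fun h => hab (h.trans hb.symm)⟩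
      · exact ⟨a, b, rfl, hb⟩
  choose f hfv hfc hfF using hn
  have hr : ∀ l, ∃ x : (P ⁻¹' {l} : Set W), (P v = l → x = v) ∧ (P w = l → x = w) := by
    intro l
    by_cases h1 : P v = l
    · exact ⟨⟨v, h1⟩, fun _ => rfl, fun h => absurd (h.trans h1.symm) hwv⟩
    · by_cases h2 : P w = l
      · exact ⟨⟨w, h2⟩, fun h => absurd h h1, fun _ => rfl⟩
      · obtain ⟨x, hx⟩ := hP l
        exact ⟨⟨x, hx⟩, fun h => absurd h h1, fun h => absurd h h2⟩
  choose r hrv hrw using hr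
  let S : Finset W := Finset.univ.biUnion fun l =>
    (f l (r l)).map (Function.Embedding.subtype _)
  have hmem : ∀ l x, x ∈ f l (r l) → (x : W) ∈ S := by
    intro l x hx
    exact Finset.mem_biUnion.2 ⟨l, Finset.mem_univ _, Finset.mem_map.2 ⟨x, hx, rfl⟩⟩
  have hvS : v ∈ S := by
    have := hmem (P v) _ (hfv _ (r (P v)))
    rwa [hrv _ rfl] at this
  have hwS : w ∈ S := by
    have := hmem (P w) _ (hfv _ (r (P w)))
    rwa [hrw _ rfl] at this
  refine ⟨S, hvS, ?_, ?_⟩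
  · refine Finset.card_biUnion_le.trans (Finset.sum_le_sum fun l _ => ?_)
    rw [Finset.card_map]; exact hfc _ _
  refine isFVS_of_cycles fun u c hc => ?_
  by_contra! hS
  have hne0 : s(a, w) ∉ c.edges := fun h => hS w (c.snd_mem_support_of_mem_edges h) hwS
  have hG' := two_conn_edge h2 he0.1
  have hcH : ∀ x y, s(x, y) ∈ c.edges → H.Adj x y := by
    intro x y hxy
    by_contra hnH
    have hf : s(x, y) ∈ G.edgeSet \ H.edgeSet := ⟨c.adj_of_mem_edges hxy, hnH⟩
    have hne : s(x, y) ≠ s(a, w) := fun h => hne0 (h ▸ hxy)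
    have hnb : ¬ (G.deleteEdges {s(a, w)}).IsBridge s(x, y) := by
      intro hb
      have htr : ∀ e ∈ c.edges, e ∈ (G.deleteEdges {s(a, w)}).edgeSet := by
        intro e he
        rw [edgeSet_deleteEdges]
        exact ⟨c.edges_subset_edgeSet he, fun h => hne0 (h ▸ he)⟩
      exact hb.notMem_edges_of_isCycle (hc.transfer htr) (by rwa [Walk.edges_transfer])
    have hK := hG'.connected_delete_edge_of_not_isBridge hnb
    have hb := quotient_bound hP hH hK
    have hsub : ((G.deleteEdges {s(a, w)}).deleteEdges {s(x, y)}).edgeSet \ H.edgeSet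
        = ((G.edgeSet \ H.edgeSet) \ {s(a, w)}) \ {s(x, y)} := by
      ext e
      simp only [edgeSet_deleteEdges, Set.mem_sdiff]
      tauto
    rw [hsub] at hb
    have e1 := Set.ncard_sdiff_singleton_add_one he0 (Set.toFinite _)
    have e2 := Set.ncard_sdiff_singleton_add_one
      (show s(x, y) ∈ (G.edgeSet \ H.edgeSet) \ {s(a, w)} from ⟨hf, hne⟩) (Set.toFinite _)
    omega
  let X : Finset (P ⁻¹' {P u} : Set W) := Finset.subtype _ c.support.toFinset
  have hX : ∀ x, x ∈ X ↔ (x : W) ∈ c.support := by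
    intro x; simp [X]
  have hcore : Core (H.induce (P ⁻¹' {P u})) X := by
    refine ⟨⟨⟨u, rfl⟩, (hX _).2 c.start_mem_support⟩, fun x hx => ?_⟩
    obtain ⟨p, q, hpq, hp, hq⟩ := cycle_nbrs hc ((hX _).1 hx)
    refine ⟨⟨p, ?_⟩, (hX _).2 (c.snd_mem_support_of_mem_edges hp), ⟨q, ?_⟩,
      (hX _).2 (c.snd_mem_support_of_mem_edges hq), ?_, hcH _ _ hp, hcH _ _ hq⟩
    · exact (hH _ _ (hcH _ _ hp)).symm.trans x.2
    · exact (hH _ _ (hcH _ _ hq)).symm.trans x.2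
    · exact fun h => hpq (congrArg Subtype.val h)
  obtain ⟨x, hx, hxS⟩ := hfF _ (r (P u)) X hcore
  exact hS x ((hX _).1 hx) (hmem _ _ hxS)

/-! ### Counting -/

theorem forest_edges {U : Type} [Finite U] [Nonempty U] {K : SimpleGraph U} (h : K.IsAcyclic) :
    K.edgeSet.ncard + 1 ≤ Nat.card U := by
  classical
  have := Fintype.ofFinite U
  obtain ⟨F, hKF, -, hF⟩ := (connected_top (V := U)).exists_isTree_le_of_le_of_isAcyclic le_top h
  have h1 := hF.card_edgeFinset
  have h2 := Set.ncard_le_ncard (edgeSet_mono hKF) (Set.toFinite _)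
  rw [← SimpleGraph.coe_edgeFinset F, Set.ncard_coe_finset] at h2
  rw [Nat.card_eq_fintype_card]
  omega

theorem subcubic_degree {U : Type} [Fintype U] {K : SimpleGraph U} [DecidableRel K.Adj]
    (h3 : Subcubic K) (v : U) : K.degree v ≤ 3 := by
  have := h3 v
  rwa [← SimpleGraph.coe_neighborFinset, Set.ncard_coe_finset, card_neighborFinset_eq_degree]
    at this

theorem fvs_lower {U : Type} [Finite U] [Nonempty U] {K : SimpleGraph U} (h3 : Subcubic K)
    (T : Finset U) (hT : IsFVS K (T : Set U)) :
    K.edgeSet.ncard + 1 ≤ Nat.card U + 2 * T.card := by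
  classical
  have := Fintype.ofFinite U
  rw [Nat.card_eq_fintype_card]
  by_cases hne : Nonempty ((T : Set U)ᶜ : Set U)
  · have hf := forest_edges hT
    have hcT : Nat.card ((T : Set U)ᶜ : Set U) + T.card = Fintype.card U := by
      have := Set.ncard_add_ncard_compl (T : Set U)
      rw [Set.ncard_coe_finset, Nat.card_eq_fintype_card] at this
      rw [Nat.card_coe_set_eq]; omega
    let I : Finset (Sym2 U) := T.biUnion fun t => K.incidenceFinset t
    have hI : I.card ≤ T.card * 3 := by
      refine Finset.card_biUnion_le_card_mul _ _ _ fun t _ => ?_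
      rw [card_incidenceFinset_eq_degree]
      exact subcubic_degree h3 t
    have hsub : K.edgeSet ⊆ (I : Set (Sym2 U)) ∪
        Sym2.map Subtype.val '' (K.induce ((T : Set U)ᶜ)).edgeSet := by
      intro e he
      induction e with
      | _ x y =>
        by_cases hx : x ∈ T
        · left
          exact Finset.mem_coe.2 (Finset.mem_biUnion.2 ⟨x, hx, by
            rw [mem_incidenceFinset]; exact ⟨he, by simp⟩⟩)
        · by_cases hy : y ∈ T
          · left
            exact Finset.mem_coe.2 (Finset.mem_biUnion.2 ⟨y, hy, by
              rw [mem_incidenceFinset]; exact ⟨he, by simp⟩⟩)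
          · right
            exact ⟨s(⟨x, hx⟩, ⟨y, hy⟩), he, by simp⟩
    have h1 := Set.ncard_le_ncard hsub (Set.toFinite _)
    have h2 := Set.ncard_union_le (I : Set (Sym2 U))
      (Sym2.map Subtype.val '' (K.induce ((T : Set U)ᶜ)).edgeSet)
    have h4 := Set.ncard_image_le (f := Sym2.map Subtype.val)
      (Set.toFinite (K.induce ((T : Set U)ᶜ)).edgeSet)
    rw [Set.ncard_coe_finset] at h2
    omega
  · have hTu : T = Finset.univ := by
      ext x
      simp only [Finset.mem_univ, iff_true]
      by_contra hx
      exact hne ⟨⟨x, hx⟩⟩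
    have h1 := K.sum_degrees_eq_twice_card_edges
    have h2 : ∑ v, K.degree v ≤ Fintype.card U * 3 := by
      have := Finset.sum_le_card_nsmul Finset.univ (fun v => K.degree v) 3
        (fun v _ => subcubic_degree h3 v)
      simpa using this
    have h4 : 0 < Fintype.card U := Fintype.card_pos
    rw [← SimpleGraph.coe_edgeFinset K, Set.ncard_coe_finset, hTu, Finset.card_univ]
    omega

theorem edges_parts {W : Type} [Finite W] {H : SimpleGraph W} {k : ℕ} (P : W → Fin (k + 1)) :
    ∑ l, (H.induce (P ⁻¹' {l})).edgeSet.ncard ≤ H.edgeSet.ncard := by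
  classical
  have := Fintype.ofFinite W
  let E : Fin (k + 1) → Set (Sym2 W) := fun l =>
    Sym2.map Subtype.val '' (H.induce (P ⁻¹' {l})).edgeSet
  have hE : ∀ l, (E l).toFinset.card = (H.induce (P ⁻¹' {l})).edgeSet.ncard := by
    intro l
    rw [← Set.ncard_eq_toFinset_card']
    exact Set.ncard_image_of_injective _ (Sym2.map.injective Subtype.val_injective)
  have hEP : ∀ l e, e ∈ E l → e ∈ H.edgeSet ∧ ∀ x ∈ e, P x = l := by
    rintro l _ ⟨f, hf, rfl⟩
    induction f with
    | _ x y =>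
      refine ⟨hf, ?_⟩
      intro z hz
      simp only [Sym2.map_mk, Sym2.mem_iff] at hz
      rcases hz with rfl | rfl
      · exact x.2
      · exact y.2
  rw [← Finset.sum_congr rfl (fun l _ => hE l), ← Finset.card_biUnion, ← Set.ncard_coe_finset]
  · apply Set.ncard_le_ncard _ (Set.toFinite _)
    intro e he
    simp only [Finset.coe_biUnion, Set.mem_iUnion, Set.coe_toFinset] at he
    obtain ⟨l, _, he⟩ := he
    exact (hEP l e he).1
  · intro l _ m _ hlm
    change Disjoint (E l).toFinset (E m).toFinset
    rw [Finset.disjoint_left]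
    intro e h1 h2
    rw [Set.mem_toFinset] at h1 h2
    induction e with
    | _ x y => exact hlm (((hEP _ _ h1).2 x (by simp)).symm.trans ((hEP _ _ h2).2 x (by simp)))

/-- Any feedback set of `K` (containing all edges of `H` but `ab`) has to be large. -/
theorem parts_lower {W : Type} [Finite W] {G H K : SimpleGraph W} {k : ℕ} {P : W → Fin (k + 1)}
    (hP : Function.Surjective P) (hHG : H ≤ G) (h3 : Subcubic G)
    (n : Fin (k + 1) → ℕ)
    (hn : ∀ l, 2 * n l + Nat.card (P ⁻¹' {l} : Set W) ≤
      (H.induce (P ⁻¹' {l})).edgeSet.ncard + 2)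
    (a b : W) (hK : ∀ u v, H.Adj u v → s(u, v) ≠ s(a, b) → K.Adj u v)
    (S : Finset W) (hS : IsFVS K (S : Set W)) : ∑ l, n l ≤ S.card + 1 := by
  classical
  have := Fintype.ofFinite W
  have key : ∀ l, n l ≤ (S.filter (fun x => P x = l)).card + if P a = l then 1 else 0 := by
    intro l
    have : Nonempty (P ⁻¹' {l} : Set W) := by
      obtain ⟨x, hx⟩ := hP l
      exact ⟨⟨x, hx⟩⟩
    let M := (H.deleteEdges {s(a, b)}).induce (P ⁻¹' {l})
    let T : Finset (P ⁻¹' {l} : Set W) := S.subtype _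
    have hTc : T.card = (S.filter (fun x => P x = l)).card := by
      simp only [T, Finset.card_subtype]
      congr 1
      ext x
      simp
    have hM3 : Subcubic M := by
      intro x
      refine le_trans ?_ (h3 x)
      rw [← Set.ncard_image_of_injective _ (Subtype.val_injective)]
      apply Set.ncard_le_ncard _ (Set.toFinite _)
      rintro _ ⟨y, hy, rfl⟩
      have hy' : (H.deleteEdges {s(a, b)}).Adj x y := hy
      exact hHG (deleteEdges_le _ hy')
    have hMF : IsFVS M (T : Set _) := by
      let f : M.induce ((T : Set (P ⁻¹' {l} : Set W))ᶜ) →g K.induce ((S : Set W)ᶜ) :=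
        ⟨fun x => ⟨x.1.1, fun h => x.2 (by
          have h' : (x.1 : W) ∈ S := h
          simpa [T] using h')⟩, fun {x y} hxy => by
          have hxy' : (H.deleteEdges {s(a, b)}).Adj x.1.1 y.1.1 := hxy
          rw [deleteEdges_adj] at hxy'
          exact hK _ _ hxy'.1 hxy'.2⟩
      refine IsAcyclic.comap f ?_ hS
      intro x y hxy
      have : x.1.1 = y.1.1 :=
        congrArg (fun z : ((S : Set W)ᶜ : Set W) => (z : W)) hxy
      exact Subtype.ext (Subtype.ext this)
    have hl := fvs_lower hM3 T hMF
    have hed : (H.induce (P ⁻¹' {l})).edgeSet.ncard ≤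
        M.edgeSet.ncard + if P a = l then 1 else 0 := by
      split_ifs with hal
      · by_cases hbl : P b = l
        · have hsub : (H.induce (P ⁻¹' {l})).edgeSet ⊆
              M.edgeSet ∪ {s(⟨a, hal⟩, ⟨b, hbl⟩)} := by
            intro e he
            induction e with
            | _ x y =>
              by_cases hxy : s((x : W), (y : W)) = s(a, b)
              · right
                apply Sym2.map.injective Subtype.val_injective
                exact hxy
              · left
                exact (deleteEdges_adj).2 ⟨he, hxy⟩
          refine (Set.ncard_le_ncard hsub (Set.toFinite _)).trans ?_
          refine (Set.ncard_union_le _ _).trans ?_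
          simp
        · refine le_trans (Set.ncard_le_ncard ?_ (Set.toFinite _)) (Nat.le_succ _)
          intro e he
          induction e with
          | _ x y =>
            refine (deleteEdges_adj).2 ⟨he, fun h => hbl ?_⟩
            have h' : s((x : W), (y : W)) = s(a, b) := h
            have : b ∈ s((x : W), (y : W)) := by rw [h']; simp
            rcases Sym2.mem_iff.1 this with rfl | rfl
            · exact x.2
            · exact y.2
      · refine Set.ncard_le_ncard ?_ (Set.toFinite _)
        intro e he
        induction e with
        | _ x y =>
          refine (deleteEdges_adj).2 ⟨he, fun h => hal ?_⟩
          have h' : s((x : W), (y : W)) = s(a, b) := h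
          have : a ∈ s((x : W), (y : W)) := by rw [h']; simp
          rcases Sym2.mem_iff.1 this with rfl | rfl
          · exact x.2
          · exact y.2
    have := hn l
    split_ifs at hed ⊢ <;> omega
  have h1 := Finset.sum_le_sum (s := Finset.univ) (fun l _ => key l)
  rw [Finset.sum_add_distrib, ← Finset.card_eq_sum_card_fiberwise (fun _ _ => by simp)] at h1
  simpa using h1

/-! ### The graph `R` -/

theorem fv_of_rank {V : Type} {G : SimpleGraph V} (S : Finset V) (r : V → ℕ)
    (h : ∀ x a b, ¬ ((x ∉ S ∧ a ∉ S ∧ b ∉ S) ∧ (G.Adj x a ∧ G.Adj x b) ∧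
      (r x ≤ r a ∧ r x ≤ r b) ∧ a ≠ b)) : FV G S := by
  intro X hX
  by_contra! hd
  obtain ⟨x, hx, hmin⟩ := X.exists_min_image r hX.1
  obtain ⟨a, ha, b, hb, hab, h1, h2⟩ := hX.2 x hx
  exact h x a b ⟨⟨hd x hx, hd a ha, hd b hb⟩, ⟨h1, h2⟩, ⟨hmin a ha, hmin b hb⟩, hab⟩

instance decPetersen : DecidableRel petersen.Adj := by
  unfold petersen; infer_instance

instance decR : DecidableRel Rgraph.Adj := by
  unfold Rgraph; infer_instance

/-- Rank function given by a list of vertices. -/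
def rk (l : List (ZMod 5 × Fin 2)) (x : ZMod 5 × Fin 2) : ℕ := l.idxOf x

theorem R_fv (v : ZMod 5 × Fin 2) :
    ∃ S : Finset (ZMod 5 × Fin 2), v ∈ S ∧ S.card ≤ 3 ∧ FV Rgraph S := by
  have h1 : FV Rgraph {(0, 0), (1, 1), (2, 1)} := fv_of_rank _
    (rk [(0, 1), (1, 0), (2, 0), (3, 1), (3, 0), (4, 0), (4, 1)]) (by decide +kernel)
  have h2 : FV Rgraph {(0, 0), (1, 1), (3, 0)} := fv_of_rank _
    (rk [(1, 0), (2, 0), (3, 1), (0, 1), (2, 1), (4, 0), (4, 1)]) (by decide +kernel)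
  have h3 : FV Rgraph {(0, 1), (1, 0), (4, 1)} := fv_of_rank _
    (rk [(0, 0), (1, 1), (2, 1), (2, 0), (3, 1), (3, 0), (4, 0)]) (by decide +kernel)
  have h4 : FV Rgraph {(2, 0), (3, 1), (4, 0)} := fv_of_rank _
    (rk [(0, 0), (0, 1), (1, 0), (1, 1), (2, 1), (3, 0), (4, 1)]) (by decide +kernel)
  have hv : v ∈ ({(0, 0), (1, 1), (2, 1)} : Finset (ZMod 5 × Fin 2)) ∨
      v ∈ ({(0, 0), (1, 1), (3, 0)} : Finset (ZMod 5 × Fin 2)) ∨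
      v ∈ ({(0, 1), (1, 0), (4, 1)} : Finset (ZMod 5 × Fin 2)) ∨
      v ∈ ({(2, 0), (3, 1), (4, 0)} : Finset (ZMod 5 × Fin 2)) := by
    revert v; decide +kernel
  rcases hv with hv | hv | hv | hv
  · exact ⟨_, hv, Finset.card_le_three, h1⟩
  · exact ⟨_, hv, Finset.card_le_three, h2⟩
  · exact ⟨_, hv, Finset.card_le_three, h3⟩
  · exact ⟨_, hv, Finset.card_le_three, h4⟩

theorem R_edges : 14 ≤ Rgraph.edgeSet.ncard := by
  have h1 := Rgraph.sum_degrees_eq_twice_card_edges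
  have h2 : ∑ v, Rgraph.degree v = 28 := by decide +kernel
  rw [← SimpleGraph.coe_edgeFinset Rgraph, Set.ncard_coe_finset]
  omega

/-! ### Data extracted from membership in `F^g_{i,j,k}` -/

theorem fv_iso_all {V W : Type} {G : SimpleGraph V} {H : SimpleGraph W} {m : ℕ} (e : G ≃g H)
    (h : ∀ v, ∃ S : Finset W, v ∈ S ∧ S.card ≤ m ∧ FV H S) :
    ∀ v, ∃ S : Finset V, v ∈ S ∧ S.card ≤ m ∧ FV G S := by
  intro v
  obtain ⟨S, hv, hc, hS⟩ := h (e v)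
  refine ⟨_, Finset.mem_map.2 ⟨_, hv, ?_⟩, ?_, hS.iso e.toEquiv (fun u v h => e.map_adj_iff.2 h)⟩
  · exact e.symm_apply_apply v
  · simpa using hc

theorem copies {g i j k : ℕ} {W : Type} [Finite W] {H : SimpleGraph W} {P : W → Fin (k + 1)}
    (c m : ℕ)
    (h0 : MemF i j (H.induce (P ⁻¹' {0})))
    (hcm : g = 4 ∧ c = 2 ∧ m = 8 ∨ g = 5 ∧ c = 3 ∧ m = 14)
    (hl : (g = 4 ∧ ∀ l : Fin (k + 1), l ≠ 0 → Nonempty ((H.induce (P ⁻¹' {l})) ≃g Lgraph)) ∨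
     (g = 5 ∧ ∀ l : Fin (k + 1), l ≠ 0 → Nonempty ((H.induce (P ⁻¹' {l})) ≃g Rgraph))) :
    Function.Surjective P ∧ ∃ n : Fin (k + 1) → ℕ, ∑ l, n l = j + 1 + c * k ∧
      (∀ l, ∀ v : (P ⁻¹' {l} : Set W), ∃ S : Finset (P ⁻¹' {l} : Set W),
        v ∈ S ∧ S.card ≤ n l ∧ FV (H.induce (P ⁻¹' {l})) S) ∧
      (∀ l, 2 * n l + Nat.card (P ⁻¹' {l} : Set W) ≤
        (H.induce (P ⁻¹' {l})).edgeSet.ncard + 2) ∧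
      i + 5 * j + m * k ≤ H.edgeSet.ncard := by
  obtain ⟨hg0, hf0, hv0, he0, hi0⟩ := memF_all h0
  have hc : ∀ l : Fin (k + 1), l ≠ 0 →
      (∀ v : (P ⁻¹' {l} : Set W), ∃ S : Finset (P ⁻¹' {l} : Set W),
        v ∈ S ∧ S.card ≤ c ∧ FV (H.induce (P ⁻¹' {l})) S) ∧
      Nat.card (P ⁻¹' {l} : Set W) + 2 * c = m + 2 ∧ 1 ≤ Nat.card (P ⁻¹' {l} : Set W) ∧
      m ≤ (H.induce (P ⁻¹' {l})).edgeSet.ncard := by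
    intro l hl0
    rcases hl with ⟨rfl, hl⟩ | ⟨rfl, hl⟩
    · obtain ⟨e⟩ := hl l hl0
      obtain ⟨hg, hf, hv, he, -⟩ := memF_all memF_L
      obtain ⟨-, rfl, rfl⟩ : 4 = 4 ∧ c = 2 ∧ m = 8 := by omega
      rw [Nat.card_congr e.toEquiv, iso_edges e, hv]
      exact ⟨fv_iso_all e hg.1, by omega, by omega, by omega⟩
    · obtain ⟨e⟩ := hl l hl0
      obtain ⟨-, rfl, rfl⟩ : 5 = 5 ∧ c = 3 ∧ m = 14 := by omega
      rw [Nat.card_congr e.toEquiv, iso_edges e]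
      have : Nat.card (ZMod 5 × Fin 2) = 10 := by simp
      exact ⟨fv_iso_all e R_fv, by omega, by omega, R_edges⟩
  refine ⟨fun l => ?_, fun l => if l = 0 then j + 1 else c, ?_, ?_, ?_, ?_⟩
  · have : 0 < Nat.card (P ⁻¹' {l} : Set W) := by
      by_cases h : l = 0
      · subst h; omega
      · exact (hc l h).2.2.1
    obtain ⟨⟨x, hx⟩⟩ := (Nat.card_pos_iff.1 this).1
    exact ⟨x, hx⟩
  · rw [Fin.sum_univ_succ]
    simp [Fin.succ_ne_zero, mul_comm]
  · intro l
    beta_reduce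
    split_ifs with h
    · subst h; exact hg0.1
    · exact (hc l h).1
  · intro l
    beta_reduce
    split_ifs with h
    · subst h; omega
    · have := hc l h; omega
  · refine le_trans ?_ (edges_parts P)
    rw [Fin.sum_univ_succ]
    have : ∑ _l : Fin k, m ≤ ∑ l : Fin k, (H.induce (P ⁻¹' {l.succ})).edgeSet.ncard :=
      Finset.sum_le_sum fun l _ => (hc _ (Fin.succ_ne_zero l)).2.2.2
    simp only [Finset.sum_const, Finset.card_univ, Fintype.card_fin, smul_eq_mul] at this
    rw [mul_comm] at this
    omega

theorem memFG_upper {g i j k : ℕ} {W : Type} [Finite W] {G : SimpleGraph W} (hk : 1 ≤ k)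
    (h : MemFG g i j k G) (c m : ℕ)
    (hcm : g = 4 ∧ c = 2 ∧ m = 8 ∨ g = 5 ∧ c = 3 ∧ m = 14) (v : W) :
    ∃ S : Finset W, v ∈ S ∧ S.card ≤ j + 1 + c * k ∧ IsFVS G (S : Set W) := by
  obtain ⟨h2, h3, P, H, hHG, hH, h0, hl, hcard, hd⟩ := h
  obtain ⟨hP, n, hs, hn, -, -⟩ := copies c m h0 hcm hl
  obtain ⟨S, h⟩ := glue hP hH h2 hcard (hd hk) n hn v
  rw [hs] at h
  exact ⟨S, h⟩

theorem memFG_edges {g i j k : ℕ} {W : Type} [Finite W] {G : SimpleGraph W}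
    (h : MemFG g i j k G) (c m : ℕ)
    (hcm : g = 4 ∧ c = 2 ∧ m = 8 ∨ g = 5 ∧ c = 3 ∧ m = 14) :
    i + 5 * j + m * k + k + 1 ≤ G.edgeSet.ncard := by
  obtain ⟨h2, h3, P, H, hHG, hH, h0, hl, hcard, hd⟩ := h
  obtain ⟨hP, n, hs, hn, -, he⟩ := copies c m h0 hcm hl
  have := Set.ncard_sdiff_add_ncard_of_subset (edgeSet_mono hHG) (Set.toFinite _)
  omega

theorem memFG_zero {g i j k i' j' : ℕ} {W : Type} [Finite W] {G : SimpleGraph W} (hk : 1 ≤ k)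
    (h : MemFG g i j k G) (h' : MemFG g i' j' 0 G) (c m : ℕ)
    (hcm : g = 4 ∧ c = 2 ∧ m = 8 ∨ g = 5 ∧ c = 3 ∧ m = 14) :
    j + c * k ≤ j' := by
  obtain ⟨h2, h3, P, H, hHG, hH, h0, hl, hcard, hd⟩ := h
  obtain ⟨hP, n, hs, -, hn, he⟩ := copies c m h0 hcm hl
  obtain ⟨-, -, P', H', hHG', -, h0', -, hcard', -⟩ := h'
  have huniv : P' ⁻¹' {0} = Set.univ := by
    ext x
    simp only [Set.mem_preimage, Set.mem_singleton_iff, Set.mem_univ, iff_true]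
    exact Fin.ext (by omega)
  rw [huniv] at h0'
  have hgood : Good j' H' := (memF_all h0').1.iso (induceUnivIso H').symm
  obtain ⟨e0, he0⟩ := Set.ncard_eq_one.1 (hcard'.trans (by rfl))
  obtain ⟨f, hf, hfe⟩ : ∃ f ∈ G.edgeSet \ H.edgeSet, f ≠ e0 :=
    Set.exists_ne_of_one_lt_ncard (by omega) e0
  have hH' : ∀ e, e ∈ G.edgeSet → e ≠ e0 → e ∈ H'.edgeSet := by
    intro e he hne
    by_contra hn
    have : e ∈ G.edgeSet \ H'.edgeSet := ⟨he, hn⟩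
    rw [he0] at this
    exact hne this
  have hfH' := hH' f hf.1 hfe
  induction e0 with
  | _ a b =>
    induction f with
    | _ p q =>
      obtain ⟨S, hSc, hS⟩ := hgood.2 p q hfH'
      have := parts_lower (K := H'.deleteEdges {s(p, q)}) hP hHG h3 n hn a b (by
        intro u v huv hne
        rw [deleteEdges_adj]
        refine ⟨hH' _ (hHG huv) hne, fun heq => hf.2 ?_⟩
        rw [← Set.mem_singleton_iff.1 heq]
        exact huv) S hS.isFVS
      omega
/-- for `G ∈ F_{i,j} ∪ F^g_{i,j,k}` (with `k ≥ 1`) and any vertex `v`,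
`G` has a feedback vertex set of size at most `t_g |E(G)| + ε_g(G)` containing `v`. -/
theorem statement12 (g : ℕ) (hg : g = 4 ∨ g = 5) (i j k : ℕ)
    (hi : 1 ≤ i) (hj : j ≤ i) (hk : 1 ≤ k)
    {V : Type} [Fintype V] (G : SimpleGraph V)
    (hG : MemF i j G ∨ MemFG g i j k G) (v : V) :
    ∃ S : Set V, IsFVS G S ∧ v ∈ S ∧
      (S.ncard : ℝ) ≤ tg g * G.edgeSet.ncard + eps g G := by
  classical
  by_cases h1 : ∃ p : ℕ × ℕ, 1 ≤ p.1 ∧ p.2 ≤ p.1 ∧ MemF p.1 p.2 G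
  · obtain ⟨hgood, -, -, hE, -⟩ := memF_all h1.choose_spec.2.2
    obtain ⟨S, hvS, hSc, hS⟩ := hgood.1 v
    refine ⟨S, hS.isFVS, hvS, ?_⟩
    have heps : 1 - (h1.choose.2 : ℝ) * (5 * tg g - 1) - (h1.choose.1 : ℝ) * tg g ≤ eps g G := by
      unfold eps
      rw [dif_pos h1]
      exact le_max_left _ _
    generalize h1.choose = p at *
    have hE' : (p.1 : ℝ) + 5 * p.2 ≤ G.edgeSet.ncard := by exact_mod_cast hE
    have hSc' : ((S : Set V).ncard : ℝ) ≤ p.2 + 1 := by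
      rw [Set.ncard_coe_finset]; exact_mod_cast hSc
    rcases hg with rfl | rfl <;> norm_num [tg] at heps hSc' ⊢ <;> linarith
  · have hFG : MemFG g i j k G := hG.resolve_left fun h => h1 ⟨(i, j), hi, hj, h⟩
    have h2 : ∃ q : ℕ × ℕ × ℕ, 1 ≤ q.1 ∧ q.2.1 ≤ q.1 ∧ MemFG g q.1 q.2.1 q.2.2 G :=
      ⟨(i, j, k), hi, hj, hFG⟩
    have heps : 1 - tg g - (h2.choose.2.1 : ℝ) * (5 * tg g - 1) - (h2.choose.1 : ℝ) * tg g
        ≤ eps g G := by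
      unfold eps
      rw [dif_neg h1, dif_pos h2]
      exact le_max_left _ _
    have hq := h2.choose_spec.2.2
    generalize h2.choose = q at *
    obtain ⟨i', j', k'⟩ := q
    simp only at heps hq
    obtain ⟨c, m, hcm⟩ : ∃ c m : ℕ, g = 4 ∧ c = 2 ∧ m = 8 ∨ g = 5 ∧ c = 3 ∧ m = 14 := by
      rcases hg with rfl | rfl
      · exact ⟨2, 8, by simp⟩
      · exact ⟨3, 14, by simp⟩
    have hE := memFG_edges hq c m hcm
    obtain ⟨S, hvS, hSc, hS⟩ : ∃ S : Finset V, v ∈ S ∧ S.card ≤ j' + 1 + c * k' ∧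
        IsFVS G (S : Set V) := by
      rcases Nat.eq_zero_or_pos k' with rfl | hk'
      · have h0 := memFG_zero hk hFG hq c m hcm
        obtain ⟨S, hvS, hSc, hS⟩ := memFG_upper hk hFG c m hcm v
        exact ⟨S, hvS, by omega, hS⟩
      · exact memFG_upper hk' hq c m hcm v
    refine ⟨S, hS, hvS, ?_⟩
    have hSc' : ((S : Set V).ncard : ℝ) ≤ j' + 1 + c * k' := by
      rw [Set.ncard_coe_finset]; exact_mod_cast hSc
    have hE' : (i' : ℝ) + 5 * j' + m * k' + k' + 1 ≤ G.edgeSet.ncard := by exact_mod_cast hE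
    rcases hcm with ⟨rfl, rfl, rfl⟩ | ⟨rfl, rfl, rfl⟩ <;> norm_num [tg] at heps hSc' hE' ⊢ <;>
      linarith

end InducedForest
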